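/- arXiv:2108.13625 — 10 statements merged into one kernel-verified Lean document; each statement's English description precedes it below -/
import Mathlib

section
/- Let F be a finite field with q elements whose characteristic is not 3, and let c ∈ F. Then the number of monic cubics with subleading coefficient c over F that are irreducible equals (q² − 1)/3. -/
open Polynomial

/-- A polynomial is of the form `X³ + cX² + aX + b` iff it is a monic cubic whose subleading
coefficient is `c`. -/
lemma exists_eq_cubic_iff {R : Type*} [CommRing R] [Nontrivial R] {c : R} {p : R[X]} :
    (∃ a b : R, p = X ^ 3 + C c * X ^ 2 + C a * X + C b) ↔
      p.Monic ∧ p.natDegree = 3 ∧ p.nextCoeff = c := by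
  constructor
  · rintro ⟨a, b, rfl⟩
    have hd : (X ^ 3 + C c * X ^ 2 + C a * X + C b : R[X]).natDegree = 3 := by
      compute_degree!
    refine ⟨by monicity!, hd, ?_⟩
    rw [nextCoeff_of_natDegree_pos (by omega), hd]
    simp
  · rintro ⟨hm, hd, rfl⟩
    refine ⟨p.coeff 1, p.coeff 0, ?_⟩
    have h3 : p.coeff 3 = 1 := by rw [← hd]; exact hm
    rw [nextCoeff_of_natDegree_pos (by omega), hd]
    conv_lhs => rw [p.as_sum_range_C_mul_X_pow, hd]
    simp only [Finset.sum_range_succ, Finset.sum_range_zero, h3]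
    simp only [map_one]
    ring

namespace FiniteField

/-- The fibres of the trace of an extension of finite fields all have the same size. -/
lemma card_mul_card_trace_fiber (F L : Type*) [Field F] [Fintype F] [DecidableEq F] [Field L]
    [Fintype L] [Algebra F L] (t : F) :
    Fintype.card F * (Finset.univ.filter fun x : L ↦ Algebra.trace F L x = t).card =
      Fintype.card L := by
  have key (s : F) : (Finset.univ.filter fun x : L ↦ Algebra.trace F L x = s).card =
      (Finset.univ.filter fun x : L ↦ Algebra.trace F L x = t).card := by
    obtain ⟨y, hy⟩ := Algebra.trace_surjective F L (t - s)
    refine Finset.card_bij (fun x _ ↦ x + y) ?_ (by simp) fun x hx ↦ ⟨x - y, ?_, by simp⟩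
    · intro x hx
      simp_all
    · simp_all
  rw [← Finset.card_univ (α := L), Finset.card_eq_sum_card_fiberwise (s := (Finset.univ : Finset L))
    (t := Finset.univ) (f := Algebra.trace F L) (by simp)]
  simp [key]

/-- An irreducible polynomial over a finite field splits in an extension whose degree is that of
the polynomial. -/
lemma splits_map_of_irreducible {F L : Type*} [Field F] [Finite F] [Field L] [Finite L]
    [Algebra F L] {f : F[X]} (hf : Irreducible f) (h : f.natDegree = Module.finrank F L) :
    (f.map (algebraMap F L)).Splits := by
  have := Fintype.ofFinite L
  have hdvd := (hf.natDegree_dvd_iff_dvd_X_pow_card_pow_sub_X (n := Module.finrank F L)).1 h.dvd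
  rw [← Module.natCard_eq_pow_finrank, ← Fintype.card_eq_nat_card] at hdvd
  refine Splits.of_dvd (FiniteField.isSplittingField_sub L F).splits ?_
    (map_dvd (algebraMap F L) hdvd)
  exact Polynomial.map_ne_zero (FiniteField.X_pow_card_sub_X_ne_zero F Fintype.one_lt_card)

/-- Over a finite field, a monic irreducible polynomial of degree `n` is the minimal polynomial of
exactly `n` elements of an extension of degree `n`. -/
lemma card_minpoly_fiber {F L : Type*} [Field F] [Finite F] [DecidableEq F[X]] [Field L] [Fintype L]
    [Algebra F L] {f : F[X]} (hf : Irreducible f) (hm : f.Monic)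
    (h : f.natDegree = Module.finrank F L) :
    (Finset.univ.filter fun x : L ↦ minpoly F x = f).card = f.natDegree := by
  rw [← card_rootSet_eq_natDegree (K := L) (PerfectField.separable_of_irreducible hf)
    (splits_map_of_irreducible hf h), ← Set.toFinset_card]
  congr 1
  ext x
  simp only [Finset.mem_filter, Finset.mem_univ, true_and, Set.mem_toFinset, mem_rootSet,
    hf.ne_zero, ne_eq, not_false_eq_true]
  exact ⟨fun hx ↦ hx ▸ minpoly.aeval F x,
    fun hx ↦ (minpoly.eq_of_irreducible_of_monic hf hx hm).symm⟩

end FiniteField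

/-- In an extension of prime degree, the minimal polynomial of an element outside the base field
has full degree. -/
lemma minpoly.natDegree_eq_finrank_of_prime {F L : Type*} [Field F] [Field L] [Algebra F L]
    (hp : (Module.finrank F L).Prime) {x : L} (hx : x ∉ (algebraMap F L).range) :
    (minpoly F x).natDegree = Module.finrank F L := by
  have := Module.finite_of_finrank_pos hp.pos
  exact (hp.eq_one_or_self_of_dvd _ (minpoly.degree_dvd (.of_finite F x))).resolve_left
    fun h ↦ hx (minpoly.natDegree_eq_one_iff.1 h)

/-- Over a finite field `F` with `q` elements of characteristic `≠ 3`, for any `c ∈ F`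
the number of irreducible monic cubics with subleading coefficient `c` is `(q² - 1)/3`. -/
theorem card_irreducible_cubics_char_ne_three
    (F : Type*) [Field F] [Fintype F] (h3 : ringChar F ≠ 3) (c : F) :
    Nat.card {p : Polynomial F //
        (∃ a b : F, p = X ^ 3 + C c * X ^ 2 + C a * X + C b) ∧ Irreducible p} =
      (Fintype.card F ^ 2 - 1) / 3 := by
  classical
  obtain ⟨p, hp⟩ := CharP.exists F
  have : Fact p.Prime := ⟨CharP.char_is_prime F p⟩
  have three_ne : (3 : F) ≠ 0 := fun h ↦ by
    have hdvd : ringChar F ∣ 3 := ringChar.dvd (by exact_mod_cast h)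
    exact ((Nat.dvd_prime Nat.prime_three).1 hdvd).elim CharP.ringChar_ne_one h3
  let L := FiniteField.Extension F p 3
  have hL : Module.finrank F L = 3 := FiniteField.finrank_extension F p 3
  let : Fintype L := .ofFinite L
  have hprime : (Module.finrank F L).Prime := by rw [hL]; exact Nat.prime_three
  let P : Set F[X] :=
    {f | (∃ a b : F, f = X ^ 3 + C c * X ^ 2 + C a * X + C b) ∧ Irreducible f}
  have hP : P.Finite := by
    refine (Set.finite_range fun ab : F × F ↦
      X ^ 3 + C c * X ^ 2 + C ab.1 * X + C ab.2).subset ?_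
    rintro f ⟨⟨a, b, rfl⟩, -⟩
    exact ⟨(a, b), rfl⟩
  have trace_eq {x : L} (hx : (minpoly F x).natDegree = 3) :
      Algebra.trace F L x = -(minpoly F x).nextCoeff := by
    have hfin := IntermediateField.adjoin.finrank (Algebra.IsIntegral.isIntegral (R := F) x)
    have hmul := Module.finrank_mul_finrank F (IntermediateField.adjoin F {x}) L
    rw [trace_eq_finrank_mul_minpoly_nextCoeff]
    have : Module.finrank (IntermediateField.adjoin F {x}) L = 1 := by
      rw [hfin, hx, hL] at hmul
      omega
    rw [this]
    simp
  let A : Finset L := Finset.univ.filter fun x ↦ Algebra.trace F L x = -c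
  let S : Finset L := A.erase (algebraMap F L (-c / 3))
  have mem_S {x : L} : x ∈ S ↔ minpoly F x ∈ P := by
    simp only [S, A, P, Finset.mem_erase, Finset.mem_filter, Finset.mem_univ, true_and,
      Set.mem_ofPred_eq, exists_eq_cubic_iff,
      minpoly.irreducible (Algebra.IsIntegral.isIntegral (R := F) x),
      minpoly.monic (Algebra.IsIntegral.isIntegral (R := F) x), and_true]
    constructor
    · rintro ⟨hne, htr⟩
      have hx : x ∉ (algebraMap F L).range := by
        rintro ⟨y, rfl⟩
        rw [Algebra.trace_algebraMap, hL] at htr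
        apply hne
        congr 1
        rw [eq_div_iff three_ne, ← htr]
        simp [mul_comm]
      have hd := (minpoly.natDegree_eq_finrank_of_prime hprime hx).trans hL
      exact ⟨hd, neg_injective ((trace_eq hd).symm.trans htr)⟩
    · rintro ⟨hd, hc⟩
      refine ⟨?_, by rw [trace_eq hd, hc]⟩
      rintro rfl
      rw [minpoly.natDegree_eq_one_iff.2 ⟨_, rfl⟩] at hd
      omega
  have card_S : S.card = Fintype.card F ^ 2 - 1 := by
    have hA : A.card = Fintype.card F ^ 2 := by
      refine Nat.eq_of_mul_eq_mul_left (Fintype.card_pos (α := F)) ?_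
      refine (FiniteField.card_mul_card_trace_fiber F L (-c)).trans ?_
      rw [Module.card_eq_pow_finrank (K := F), hL]
      ring
    rw [Finset.card_erase_of_mem, hA]
    simp only [A, Finset.mem_filter, Finset.mem_univ, true_and]
    rw [Algebra.trace_algebraMap, hL, nsmul_eq_mul]
    push_cast
    field_simp
  have card_eq : S.card = hP.toFinset.card * 3 := by
    rw [Finset.card_eq_sum_card_fiberwise (f := minpoly F) (t := hP.toFinset)
      fun x hx ↦ by simpa using mem_S.1 hx]
    refine Finset.sum_const_nat fun f hf ↦ ?_
    rw [Set.Finite.mem_toFinset] at hf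
    obtain ⟨hm, hd, -⟩ := exists_eq_cubic_iff.1 hf.1
    refine Eq.trans ?_
      ((FiniteField.card_minpoly_fiber (L := L) hf.2 hm (hd.trans hL.symm)).trans hd)
    congr 1
    ext x
    simp only [Finset.mem_filter, Finset.mem_univ, true_and, and_iff_right_iff_imp]
    rintro rfl
    exact mem_S.2 hf
  have : Nat.card P = hP.toFinset.card := by
    rw [Nat.card_coe_set_eq, Set.ncard_eq_toFinset_card P hP]
  change Nat.card P = _
  omega
end

section
/- Let F be a finite field with q elements and let c ∈ F. Then the number of monic cubics with subleading coefficient c over F that factor as (X − r)·g(X) for some r ∈ F and some monic irreducible quadratic g ∈ F[X] equals (q² − q)/2. -/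
open Polynomial

/-- The coefficients `(s, t)` of the quadratic `X² + sX + t` with a given pair of roots. -/
def Sym2.quadraticCoeffs {R : Type*} [CommRing R] : Sym2 R → R × R :=
  Sym2.lift ⟨fun x y => (-(x + y), x * y), fun x y => by simp [add_comm, mul_comm]⟩

lemma Sym2.quadraticCoeffs_mk {R : Type*} [CommRing R] (x y : R) :
    Sym2.quadraticCoeffs s(x, y) = (-(x + y), x * y) := rfl

lemma Sym2.quadraticCoeffs_injective {R : Type*} [CommRing R] [IsDomain R] :
    Function.Injective (Sym2.quadraticCoeffs : Sym2 R → R × R) := by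
  intro a b
  induction a using Sym2.ind with | _ x y
  induction b using Sym2.ind with | _ z w
  simp only [Sym2.quadraticCoeffs_mk, Prod.mk.injEq, Sym2.eq_iff, neg_inj]
  rintro ⟨hadd, hmul⟩
  have h : (x - z) * (x - w) = 0 := by linear_combination x * hadd - hmul
  rcases mul_eq_zero.mp h with h | h
  · exact Or.inl ⟨sub_eq_zero.mp h, by linear_combination hadd - h⟩
  · exact Or.inr ⟨sub_eq_zero.mp h, by linear_combination hadd - h⟩

lemma Sym2.mem_range_quadraticCoeffs_iff {R : Type*} [CommRing R] (s t : R) :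
    (s, t) ∈ Set.range (Sym2.quadraticCoeffs : Sym2 R → R × R) ↔
      ∃ x, x ^ 2 + s * x + t = 0 := by
  constructor
  · rintro ⟨a, h⟩
    induction a using Sym2.ind with | _ x y
    simp only [Sym2.quadraticCoeffs_mk, Prod.mk.injEq] at h
    exact ⟨x, by rw [← h.1, ← h.2]; ring⟩
  · rintro ⟨x, hx⟩
    refine ⟨s(x, -s - x), ?_⟩
    simp only [Sym2.quadraticCoeffs_mk, Prod.mk.injEq]
    exact ⟨by ring, by linear_combination -hx⟩

namespace Polynomial

lemma natDegree_X_sq_add {R : Type*} [CommRing R] [Nontrivial R] (s t : R) :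
    (X ^ 2 + C s * X + C t).natDegree = 2 := by
  compute_degree!

lemma monic_X_sq_add {R : Type*} [CommRing R] (s t : R) :
    (X ^ 2 + C s * X + C t).Monic := by
  nontriviality R
  rw [Monic, leadingCoeff, natDegree_X_sq_add]
  simp

lemma Monic.eq_X_sq_add {R : Type*} [CommRing R] {g : R[X]} (hg : g.Monic)
    (hdeg : g.natDegree = 2) : g = X ^ 2 + C (g.coeff 1) * X + C (g.coeff 0) := by
  have h2 : g.coeff 2 = 1 := hdeg ▸ hg.coeff_natDegree
  conv_lhs => rw [g.as_sum_range_C_mul_X_pow, hdeg]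
  simp only [Finset.sum_range_succ, Finset.sum_range_zero, h2, map_one]
  ring

lemma irreducible_X_sq_add_iff {F : Type*} [Field F] (s t : F) :
    Irreducible (X ^ 2 + C s * X + C t) ↔
      (s, t) ∉ Set.range (Sym2.quadraticCoeffs : Sym2 F → F × F) := by
  rw [irreducible_iff_roots_eq_zero_of_degree_le_three (natDegree_X_sq_add s t).ge
    (by rw [natDegree_X_sq_add]; norm_num), Sym2.mem_range_quadraticCoeffs_iff,
    Multiset.eq_zero_iff_forall_notMem]
  simp [mem_roots (monic_X_sq_add s t).ne_zero]

lemma eq_of_X_sub_C_mul_eq_X_sub_C_mul {F : Type*} [Field F] {r r' : F} {g g' : F[X]}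
    (hdeg : g'.natDegree = 2) (hirr : Irreducible g')
    (h : (X - C r) * g = (X - C r') * g') : g = g' := by
  have hroot : ((X - C r') * g').IsRoot r := by simp [← h]
  have hr : r = r' := by
    rcases root_mul.mp hroot with h1 | h1
    · simpa [sub_eq_zero] using h1
    · have := degree_eq_one_of_irreducible_of_root hirr h1
      rw [degree_eq_natDegree hirr.ne_zero, hdeg] at this
      norm_num at this
  subst hr
  exact mul_left_cancel₀ (X_sub_C_ne_zero r) h

end Polynomial

lemma card_compl_range_quadraticCoeffs (F : Type*) [Field F] [Fintype F] :
    Nat.card ↥(Set.range (Sym2.quadraticCoeffs : Sym2 F → F × F))ᶜ =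
      (Fintype.card F ^ 2 - Fintype.card F) / 2 := by
  classical
  have h := Set.ncard_add_ncard_compl (Set.range (Sym2.quadraticCoeffs : Sym2 F → F × F))
  rw [← Nat.card_coe_set_eq, ← Nat.card_coe_set_eq,
    Nat.card_range_of_injective Sym2.quadraticCoeffs_injective, Nat.card_prod,
    Nat.card_eq_fintype_card, Nat.card_eq_fintype_card (α := F), Sym2.card] at h
  rw [Nat.choose_two_right] at h
  have heven := Nat.div_mul_cancel (Nat.even_mul_pred_self (Fintype.card F + 1)).two_dvd
  simp only [Nat.add_sub_cancel] at h heven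
  have hexpand : (Fintype.card F + 1) * Fintype.card F =
    Fintype.card F * Fintype.card F + Fintype.card F := by ring
  rw [sq]
  omega

/-- Over a finite field `F` with `q` elements, for any `c ∈ F` the number of monic cubics
with subleading coefficient `c` that factor as a linear factor times a monic irreducible
quadratic is `(q² - q)/2`. -/
theorem card_linear_times_irreducible_quadratic_cubics
    (F : Type*) [Field F] [Fintype F] (c : F) :
    Nat.card {p : Polynomial F //
        (∃ a b : F, p = X ^ 3 + C c * X ^ 2 + C a * X + C b) ∧
        ∃ (r : F) (g : Polynomial F), g.Monic ∧ g.natDegree = 2 ∧ Irreducible g ∧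
          p = (X - C r) * g} =
      (Fintype.card F ^ 2 - Fintype.card F) / 2 := by
  rw [← card_compl_range_quadraticCoeffs F]
  symm
  refine Nat.card_eq_of_bijective (fun v => ⟨(X - C (v.1.1 - c)) *
      (X ^ 2 + C v.1.1 * X + C v.1.2), ?_, v.1.1 - c, _, monic_X_sq_add _ _,
      natDegree_X_sq_add _ _, (irreducible_X_sq_add_iff _ _).mpr v.2, rfl⟩) ⟨?_, ?_⟩
  · refine ⟨v.1.2 - (v.1.1 - c) * v.1.1, -(v.1.1 - c) * v.1.2, ?_⟩
    simp only [map_sub, map_mul, map_neg]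
    ring
  · rintro ⟨⟨s, t⟩, hv⟩ ⟨⟨s', t'⟩, hw⟩ h
    have hg := eq_of_X_sub_C_mul_eq_X_sub_C_mul (natDegree_X_sq_add s' t')
      ((irreducible_X_sq_add_iff s' t').mpr hw) (Subtype.ext_iff.mp h)
    have h0 := congrArg (coeff · 0) hg
    have h1 := congrArg (coeff · 1) hg
    simp [coeff_X, coeff_C] at h0 h1
    simp [h0, h1]
  · rintro ⟨p, ⟨a, b, hp⟩, r, g, hmonic, hdeg, hirr, hpg⟩
    obtain ⟨s, t, rfl⟩ : ∃ s t, g = X ^ 2 + C s * X + C t :=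
      ⟨_, _, hmonic.eq_X_sq_add hdeg⟩
    refine ⟨⟨(s, t), (irreducible_X_sq_add_iff s t).mp hirr⟩, Subtype.ext ?_⟩
    have hexp : (X - C r) * (X ^ 2 + C s * X + C t) =
        X ^ 3 + C (s - r) * X ^ 2 + C (t - r * s) * X + C (-r * t) := by
      simp only [map_sub, map_mul, map_neg]
      ring
    have h2 := congrArg (coeff · 2) (hp.symm.trans (hpg.trans hexp))
    simp only [coeff_add, coeff_C_mul, coeff_X_pow, coeff_X, coeff_C] at h2
    norm_num at h2
    simp [hpg, h2]
end

section
/- Let F be a finite field with q elements whose characteristic is not 3, and let c ∈ F. Then the number of monic cubics with subleading coefficient c over F that split with three distinct roots in F equals (q − 1)(q − 2)/6. -/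
open Polynomial

/-- Translation makes the `k`-element subsets of a finite field equidistributed with respect to
the sum of their elements, provided that `k` is invertible. -/
theorem card_mul_card_powersetCard_filter_sum {F : Type*} [Field F] [Fintype F] [DecidableEq F]
    {k : ℕ} (hk : (k : F) ≠ 0) (u : F) :
    Fintype.card F * ((Finset.univ.powersetCard k).filter fun s : Finset F => ∑ r ∈ s, r = u).card =
      (Fintype.card F).choose k := by
  have sum_translate (s : Finset F) (t : F) :
      ∑ r ∈ s.map (Equiv.addRight t).toEmbedding, r = ∑ r ∈ s, r + s.card * t := by
    simp [Finset.sum_add_distrib]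
  have card_fiber_le (v w : F) :
      ((Finset.univ.powersetCard k).filter fun s : Finset F => ∑ r ∈ s, r = v).card ≤
        ((Finset.univ.powersetCard k).filter fun s : Finset F => ∑ r ∈ s, r = w).card := by
    refine Finset.card_le_card_of_injOn
      (fun s => s.map (Equiv.addRight ((w - v) / k)).toEmbedding) (fun s hs => ?_)
      (Finset.map_injective _).injOn
    obtain ⟨hcard, hsum⟩ : s.card = k ∧ ∑ r ∈ s, r = v := by
      simpa [Finset.mem_powersetCard] using hs
    rw [Finset.mem_coe, Finset.mem_filter, Finset.mem_powersetCard, sum_translate, hcard, hsum,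
      Finset.card_map, mul_div_cancel₀ _ hk]
    exact ⟨⟨Finset.subset_univ _, hcard⟩, by ring⟩
  rw [← Finset.card_univ, ← Finset.card_powersetCard k Finset.univ,
    Finset.card_eq_sum_card_fiberwise (s := Finset.univ.powersetCard k)
      (f := fun s : Finset F => ∑ r ∈ s, r) (t := Finset.univ)
      (fun _ _ => Finset.mem_coe.2 (Finset.mem_univ _)),
    Finset.sum_congr rfl fun v _ => (card_fiber_le v u).antisymm (card_fiber_le u v),
    Finset.sum_const, smul_eq_mul]

theorem prod_X_sub_C_injective (R : Type*) [CommRing R] [IsDomain R] :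
    Function.Injective fun s : Finset R => ∏ r ∈ s, (X - C r) := fun s t h =>
  Finset.val_injective <| by simpa only [roots_prod_X_sub_C] using congrArg roots h

theorem X_sub_C_mul_three {R : Type*} [CommRing R] (x y z : R) :
    (X - C x) * (X - C y) * (X - C z) =
      X ^ 3 + C (-(x + y + z)) * X ^ 2 + C (x * y + x * z + y * z) * X + C (-(x * y * z)) := by
  simp only [map_add, map_mul, map_neg]
  ring

theorem coeff_two_monic_cubic {R : Type*} [Semiring R] (c a b : R) :
    (X ^ 3 + C c * X ^ 2 + C a * X + C b : R[X]).coeff 2 = c := by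
  simp [coeff_X_pow]

theorem setOf_split_cubics_eq_image {F : Type*} [Field F] [Fintype F] [DecidableEq F] (c : F) :
    {p : Polynomial F |
        (∃ a b : F, p = X ^ 3 + C c * X ^ 2 + C a * X + C b) ∧
        ∃ r₁ r₂ r₃ : F, r₁ ≠ r₂ ∧ r₁ ≠ r₃ ∧ r₂ ≠ r₃ ∧
          p = (X - C r₁) * (X - C r₂) * (X - C r₃)} =
      (fun s : Finset F => ∏ r ∈ s, (X - C r)) ''
        ((Finset.univ.powersetCard 3).filter fun s : Finset F => ∑ r ∈ s, r = -c) := by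
  ext p
  simp only [Set.mem_ofPred_eq, Set.mem_image, Finset.mem_coe, Finset.mem_filter,
    Finset.mem_powersetCard_univ]
  constructor
  · rintro ⟨⟨a, b, hp⟩, x, y, z, hxy, hxz, hyz, hroots⟩
    refine ⟨{x, y, z}, ⟨Finset.card_eq_three.2 ⟨x, y, z, hxy, hxz, hyz, rfl⟩, ?_⟩, ?_⟩
    · have hc : p.coeff 2 = c := by rw [hp, coeff_two_monic_cubic]
      rw [hroots, X_sub_C_mul_three, coeff_two_monic_cubic] at hc
      rw [Finset.sum_insert (by simp [hxy, hxz]), Finset.sum_pair hyz, ← hc]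
      ring
    · rw [Finset.prod_insert (by simp [hxy, hxz]), Finset.prod_pair hyz, hroots, mul_assoc]
  · rintro ⟨s, ⟨hcard, hsum⟩, rfl⟩
    obtain ⟨x, y, z, hxy, hxz, hyz, rfl⟩ := Finset.card_eq_three.1 hcard
    rw [Finset.sum_insert (by simp [hxy, hxz]), Finset.sum_pair hyz, ← add_assoc] at hsum
    rw [Finset.prod_insert (by simp [hxy, hxz]), Finset.prod_pair hyz, ← mul_assoc]
    refine ⟨⟨x * y + x * z + y * z, -(x * y * z), ?_⟩, x, y, z, hxy, hxz, hyz, rfl⟩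
    rw [X_sub_C_mul_three, hsum, neg_neg]

/-- Over a finite field `F` with `q` elements of characteristic `≠ 3`, for any `c ∈ F`
the number of monic cubics with subleading coefficient `c` that split with three distinct
roots in `F` is `(q - 1)(q - 2)/6`. -/
theorem card_split_cubics_char_ne_three
    (F : Type*) [Field F] [Fintype F] (h3 : ringChar F ≠ 3) (c : F) :
    Nat.card {p : Polynomial F //
        (∃ a b : F, p = X ^ 3 + C c * X ^ 2 + C a * X + C b) ∧
        ∃ r₁ r₂ r₃ : F, r₁ ≠ r₂ ∧ r₁ ≠ r₃ ∧ r₂ ≠ r₃ ∧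
          p = (X - C r₁) * (X - C r₂) * (X - C r₃)} =
      (Fintype.card F - 1) * (Fintype.card F - 2) / 6 := by
  classical
  have hthree : ((3 : ℕ) : F) ≠ 0 := fun h =>
    ((Nat.dvd_prime Nat.prime_three).1 ((ringChar.spec F 3).1 h)).elim
      CharP.ringChar_ne_one h3
  have hcount := card_mul_card_powersetCard_filter_sum hthree (-c)
  change Set.ncard {p : Polynomial F | _} = _
  rw [setOf_split_cubics_eq_image, Set.ncard_image_of_injective _ (prod_X_sub_C_injective F),
    Set.ncard_coe_finset]
  have hchoose : (Fintype.card F).descFactorial 3 = 6 * (Fintype.card F).choose 3 :=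
    Nat.descFactorial_eq_factorial_mul_choose _ _
  rw [← hcount] at hchoose
  simp only [Nat.descFactorial, Nat.sub_zero, mul_one] at hchoose
  refine (Nat.div_eq_of_eq_mul_right (by norm_num) ?_).symm
  refine Nat.eq_of_mul_eq_mul_left (Fintype.card_pos (α := F)) ?_
  linarith
end

section
/- Let F be a finite field with q elements of characteristic 3. Then the number of monic cubics of the form X³ + aX + b over F (subleading coefficient 0) that split with three distinct roots in F equals q(q − 1)/6. -/
open Polynomial

/-- The monic cubic with roots `r`, `s` and `-(r + s)`, for `x = (r, s)`. -/
noncomputable def tracelessCubic {F : Type*} [Field F] (x : F × F) : F[X] :=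
  (X - C x.1) * (X - C x.2) * (X - C (-(x.1 + x.2)))

theorem tracelessCubic_eq {F : Type*} [Field F] (x : F × F) :
    tracelessCubic x = X ^ 3 + C (x.1 * x.2 - (x.1 + x.2) ^ 2) * X +
      C (x.1 * x.2 * (x.1 + x.2)) := by
  simp only [tracelessCubic, C_neg, C_add, C_mul, C_sub, C_pow]
  ring

theorem eval_tracelessCubic {F : Type*} [Field F] (x : F × F) (t : F) :
    (tracelessCubic x).eval t = (t - x.1) * (t - x.2) * (t - -(x.1 + x.2)) := by
  simp [tracelessCubic]

theorem root_sum_eq_zero_of_traceless {F : Type*} [Field F] {a b r s t : F}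
    (h : X ^ 3 + C a * X + C b = (X - C r) * (X - C s) * (X - C t)) : r + s + t = 0 := by
  have key : (X - C r) * (X - C s) * (X - C t) =
      X ^ 3 + C (-(r + s + t)) * X ^ 2 + C (r * s + r * t + s * t) * X + C (-(r * s * t)) := by
    simp only [C_neg, C_add, C_mul]
    ring
  have hc := congrArg (coeff · 2) (h.trans key)
  simp only [coeff_add, coeff_C_mul, coeff_X_pow, coeff_X, coeff_C] at hc
  norm_num at hc
  linear_combination hc

theorem ne_neg_add_of_ne {F : Type*} [Field F] [CharP F 3] {r s : F} (h : r ≠ s) :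
    r ≠ -(r + s) := by
  have h3 : (3 : F) = 0 := by exact_mod_cast CharP.cast_eq_zero F 3
  intro e
  exact h (by linear_combination r * h3 - e)

theorem tracelessCubic_fiber {F : Type*} [Field F] [Fintype F] [DecidableEq F]
    [DecidableEq F[X]] (r s : F) :
    {x ∈ (Finset.univ : Finset F).offDiag | tracelessCubic x = tracelessCubic (r, s)} =
      ({r, s, -(r + s)} : Finset F).offDiag := by
  ext ⟨a, b⟩
  simp only [Finset.mem_filter, Finset.mem_offDiag, Finset.mem_univ, true_and,
    Finset.mem_insert, Finset.mem_singleton]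
  constructor
  · rintro ⟨hab, h⟩
    have hroot (t : F) (ht : (tracelessCubic (a, b)).eval t = 0) :
        t = r ∨ t = s ∨ t = -(r + s) := by
      rw [h, eval_tracelessCubic] at ht
      simpa only [mul_eq_zero, sub_eq_zero, or_assoc] using ht
    exact ⟨hroot a (by simp [eval_tracelessCubic]), hroot b (by simp [eval_tracelessCubic]), hab⟩
  · rintro ⟨ha, hb, hab⟩
    refine ⟨hab, ?_⟩
    rcases ha with rfl | rfl | rfl <;> rcases hb with rfl | rfl | rfl <;>
      first
        | exact absurd rfl hab
        | (simp only [tracelessCubic, C_neg, C_add] <;> ring)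

theorem card_image_tracelessCubic {F : Type*} [Field F] [Fintype F] [CharP F 3]
    [DecidableEq F] [DecidableEq F[X]] :
    ((Finset.univ : Finset F).offDiag.image tracelessCubic).card * 6 =
      Fintype.card F * (Fintype.card F - 1) := by
  have h := Finset.card_eq_sum_card_image tracelessCubic (Finset.univ : Finset F).offDiag
  rw [Finset.sum_const_nat (m := 6)] at h
  · rw [← h, Finset.offDiag_card, Finset.card_univ, Nat.mul_sub_one]
  · intro p hp
    obtain ⟨⟨r, s⟩, hrs, rfl⟩ := Finset.mem_image.1 hp
    replace hrs : r ≠ s := (Finset.mem_offDiag.1 hrs).2.2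
    have hs : s ≠ -(r + s) := by
      rw [add_comm]
      exact ne_neg_add_of_ne hrs.symm
    rw [tracelessCubic_fiber, Finset.offDiag_card,
      Finset.card_eq_three.2 ⟨r, s, _, hrs, ne_neg_add_of_ne hrs, hs, rfl⟩]

/-- Over a finite field `F` with `q` elements of characteristic `3`, the number of monic
cubics of the form `X³ + aX + b` (subleading coefficient `0`) that split with three distinct
roots in `F` is `q(q - 1)/6`. -/
theorem card_split_traceless_cubics_char_three
    (F : Type*) [Field F] [Fintype F] [CharP F 3] :
    Nat.card {p : Polynomial F //
        (∃ a b : F, p = X ^ 3 + C a * X + C b) ∧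
        ∃ r₁ r₂ r₃ : F, r₁ ≠ r₂ ∧ r₁ ≠ r₃ ∧ r₂ ≠ r₃ ∧
          p = (X - C r₁) * (X - C r₂) * (X - C r₃)} =
      Fintype.card F * (Fintype.card F - 1) / 6 := by
  classical
  rw [← card_image_tracelessCubic, Nat.mul_div_cancel _ (by norm_num)]
  refine Nat.subtype_card _ fun p ↦ ?_
  simp only [Finset.mem_image, Finset.mem_offDiag, Finset.mem_univ, true_and, Prod.exists]
  constructor
  · rintro ⟨r, s, hrs, rfl⟩
    refine ⟨⟨_, _, tracelessCubic_eq _⟩, r, s, -(r + s), hrs, ne_neg_add_of_ne hrs, ?_, rfl⟩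
    rw [add_comm]
    exact ne_neg_add_of_ne hrs.symm
  · rintro ⟨⟨a, b, rfl⟩, r, s, t, hrs, -, -, h⟩
    refine ⟨r, s, hrs, ?_⟩
    rw [h, eq_neg_of_add_eq_zero_right (root_sum_eq_zero_of_traceless h)]
    rfl
end

section
/- Let F be a finite field with q elements of characteristic 3 and let c ∈ F with c ≠ 0. Then the number of monic cubics with subleading coefficient c over F that split with three distinct roots in F equals q(q − 3)/6. -/
open Polynomial

section SplitCubic

variable {F : Type*} [Field F]

/-- The product of the linear factors at `r`, `r + t` and `r - c - t`; in characteristic `3`,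
these three roots add up to `-c`. -/
noncomputable def splitCubic (c : F) (x : F × F) : F[X] :=
  (X - C x.1) * (X - C (x.1 + x.2)) * (X - C (x.1 - c - x.2))

lemma three_eq_zero [CharP F 3] : (3 : F) = 0 := by
  exact_mod_cast CharP.cast_eq_zero F 3

lemma add_self_ne_zero [CharP F 3] {c : F} (hc : c ≠ 0) : c + c ≠ 0 := by
  intro h
  apply hc
  linear_combination (-1 : F) * h + c * three_eq_zero (F := F)

lemma splitCubic_eq [CharP F 3] {c r s u : F} (h : r + s + u = -c) :
    splitCubic c (r, s - r) = (X - C r) * (X - C s) * (X - C u) := by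
  have hs : r + (s - r) = s := by ring
  have hu : r - c - (s - r) = u := by
    linear_combination r * three_eq_zero (F := F) - h
  simp only [splitCubic, hs, hu]

lemma splitCubic_expand [CharP F 3] (c : F) (x : F × F) :
    ∃ a b : F, splitCubic c x = X ^ 3 + C c * X ^ 2 + C a * X + C b := by
  obtain ⟨r, t⟩ := x
  refine ⟨r * (r + t) + (r + (r + t)) * (r - c - t), -(r * (r + t) * (r - c - t)), ?_⟩
  have h3 : (3 : F[X]) = 0 := by exact_mod_cast CharP.cast_eq_zero F[X] 3
  simp only [splitCubic, map_add, map_sub, map_mul, map_neg]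
  linear_combination (-C r * X ^ 2) * h3

lemma add_add_eq_neg_of_eq {a b c r s u : F}
    (h : X ^ 3 + C c * X ^ 2 + C a * X + C b = (X - C r) * (X - C s) * (X - C u)) :
    r + s + u = -c := by
  have h' : X ^ 3 + C c * X ^ 2 + C a * X + C b =
      X ^ 3 + C (-(r + s + u)) * X ^ 2 + C (r * s + r * u + s * u) * X + C (-(r * s * u)) := by
    rw [h]
    simp only [map_add, map_mul, map_neg]
    ring
  have coeff_two (a b c : F) : (X ^ 3 + C c * X ^ 2 + C a * X + C b).coeff 2 = c := by
    simp
  have hc := congrArg (coeff · 2) h'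
  simp only [coeff_two] at hc
  rw [hc, neg_neg]

variable [Fintype F] [DecidableEq F]

/-- The parameters `(r, t)` for which `splitCubic c (r, t)` has distinct roots. -/
def distinctParams (c : F) : Finset (F × F) :=
  Finset.univ ×ˢ {0, c, -c}ᶜ

lemma mem_distinctParams [CharP F 3] {c r s u : F} (h : r + s + u = -c) :
    (r, s - r) ∈ distinctParams c ↔ r ≠ s ∧ r ≠ u ∧ s ≠ u := by
  have h3 := three_eq_zero (F := F)
  have h₁ : s - r = 0 ↔ r = s := by rw [sub_eq_zero, eq_comm]
  have h₂ : s - r = c ↔ s = u := by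
    constructor <;> intro e
    · linear_combination (-1 : F) * e - h + s * h3
    · linear_combination (-1 : F) * e - h + s * h3
  have h₃ : s - r = -c ↔ r = u := by
    constructor <;> intro e
    · linear_combination e - h + r * h3
    · linear_combination e + h - r * h3
  simp only [distinctParams, Finset.mem_product, Finset.mem_univ, Finset.mem_compl,
    Finset.mem_insert, Finset.mem_singleton, h₁, h₂, h₃]
  tauto

lemma card_distinctParams [CharP F 3] {c : F} (hc : c ≠ 0) :
    (distinctParams c).card = Fintype.card F * (Fintype.card F - 3) := by
  have hcc : c ≠ -c := fun h => add_self_ne_zero hc (by linear_combination h)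
  have : ({0, c, -c} : Finset F).card = 3 :=
    Finset.card_eq_three.mpr ⟨0, c, -c, hc.symm, (neg_ne_zero.mpr hc).symm, hcc, rfl⟩
  rw [distinctParams, Finset.card_product, Finset.card_compl, this, Finset.card_univ]

lemma card_fiber_splitCubic [CharP F 3] [DecidableEq F[X]] {c : F} {x : F × F}
    (hx : x ∈ distinctParams c) :
    ((distinctParams c).filter fun y => splitCubic c y = splitCubic c x).card = 6 := by
  obtain ⟨r, t⟩ := x
  obtain ⟨s, rfl⟩ : ∃ s, t = s - r := ⟨t + r, by ring⟩
  obtain ⟨u, h⟩ : ∃ u, r + s + u = -c := ⟨-c - r - s, by ring⟩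
  obtain ⟨hrs, hru, hsu⟩ := (mem_distinctParams h).mp hx
  rw [splitCubic_eq h]
  have hcard : ({r, s, u} : Finset F).card = 3 :=
    Finset.card_eq_three.mpr ⟨r, s, u, hrs, hru, hsu, rfl⟩
  have hoff : ({r, s, u} : Finset F).offDiag.card = 6 := by
    rw [Finset.offDiag_card, hcard]
  rw [← hoff]
  refine Finset.card_nbij' (fun y => (y.1, y.1 + y.2)) (fun y => (y.1, y.2 - y.1)) ?_ ?_ ?_ ?_
  · rintro ⟨a, t⟩ hy
    obtain ⟨hy, he⟩ := Finset.mem_filter.mp hy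
    have mem_roots (z : F) (hz : (splitCubic c (a, t)).eval z = 0) :
        z ∈ ({r, s, u} : Finset F) := by
      rw [he] at hz
      simpa [sub_eq_zero, or_assoc] using hz
    refine Finset.mem_offDiag.mpr ⟨mem_roots a ?_, mem_roots (a + t) ?_, ?_⟩
    · simp [splitCubic]
    · simp [splitCubic]
    · simp only [distinctParams, Finset.mem_product, Finset.mem_compl, Finset.mem_insert] at hy
      simp only [ne_eq, left_eq_add]
      tauto
  · rintro ⟨a, b⟩ hab
    obtain ⟨v, hv, hd, hp⟩ : ∃ v, a + b + v = -c ∧ (a ≠ b ∧ a ≠ v ∧ b ≠ v) ∧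
        (X - C a) * (X - C b) * (X - C v) = (X - C r) * (X - C s) * (X - C u) := by
      simp only [Finset.coe_offDiag, Set.mem_offDiag, Finset.coe_insert, Finset.coe_singleton,
        Set.mem_insert_iff, Set.mem_singleton_iff] at hab
      obtain ⟨rfl | rfl | rfl, rfl | rfl | rfl, hne⟩ := hab
      · exact absurd rfl hne
      · exact ⟨u, h, ⟨hrs, hru, hsu⟩, rfl⟩
      · exact ⟨s, by rw [← h]; ring, ⟨hru, hrs, hsu.symm⟩, by ring⟩
      · exact ⟨u, by rw [← h]; ring, ⟨hrs.symm, hsu, hru⟩, by ring⟩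
      · exact absurd rfl hne
      · exact ⟨r, by rw [← h]; ring, ⟨hsu, hrs.symm, hru.symm⟩, by ring⟩
      · exact ⟨s, by rw [← h]; ring, ⟨hru.symm, hsu.symm, hrs⟩, by ring⟩
      · exact ⟨r, by rw [← h]; ring, ⟨hsu.symm, hru.symm, hrs.symm⟩, by ring⟩
      · exact absurd rfl hne
    exact Finset.mem_filter.mpr ⟨(mem_distinctParams hv).mpr hd, (splitCubic_eq hv).trans hp⟩
  · rintro ⟨a, t⟩ -
    simp
  · rintro ⟨a, b⟩ -
    simp

lemma mem_image_splitCubic [CharP F 3] [DecidableEq F[X]] (c : F) (p : F[X]) :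
    p ∈ (distinctParams c).image (splitCubic c) ↔
      (∃ a b : F, p = X ^ 3 + C c * X ^ 2 + C a * X + C b) ∧
        ∃ r₁ r₂ r₃ : F, r₁ ≠ r₂ ∧ r₁ ≠ r₃ ∧ r₂ ≠ r₃ ∧
          p = (X - C r₁) * (X - C r₂) * (X - C r₃) := by
  constructor
  · intro hp
    obtain ⟨⟨r, t⟩, hx, rfl⟩ := Finset.mem_image.mp hp
    refine ⟨splitCubic_expand c _, ?_⟩
    obtain ⟨s, rfl⟩ : ∃ s, t = s - r := ⟨t + r, by ring⟩
    obtain ⟨u, h⟩ : ∃ u, r + s + u = -c := ⟨-c - r - s, by ring⟩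
    obtain ⟨hrs, hru, hsu⟩ := (mem_distinctParams h).mp hx
    exact ⟨r, s, u, hrs, hru, hsu, splitCubic_eq h⟩
  · rintro ⟨⟨a, b, hp⟩, r, s, u, hrs, hru, hsu, rfl⟩
    have h := add_add_eq_neg_of_eq hp.symm
    exact Finset.mem_image.mpr
      ⟨(r, s - r), (mem_distinctParams h).mpr ⟨hrs, hru, hsu⟩, splitCubic_eq h⟩

end SplitCubic

/-- Over a finite field `F` with `q` elements of characteristic `3`, for any `c ∈ F` with
`c ≠ 0` the number of monic cubics with subleading coefficient `c` that split with three
distinct roots in `F` is `q(q - 3)/6`. -/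
theorem card_split_cubics_char_three_nonzero_trace
    (F : Type*) [Field F] [Fintype F] [CharP F 3] (c : F) (hc : c ≠ 0) :
    Nat.card {p : Polynomial F //
        (∃ a b : F, p = X ^ 3 + C c * X ^ 2 + C a * X + C b) ∧
        ∃ r₁ r₂ r₃ : F, r₁ ≠ r₂ ∧ r₁ ≠ r₃ ∧ r₂ ≠ r₃ ∧
          p = (X - C r₁) * (X - C r₂) * (X - C r₃)} =
      Fintype.card F * (Fintype.card F - 3) / 6 := by
  classical
  rw [Nat.subtype_card _ (mem_image_splitCubic c), ← card_distinctParams hc,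
    Finset.card_eq_sum_card_image (splitCubic c) (distinctParams c),
    Finset.sum_const_nat (m := 6), Nat.mul_div_cancel _ (by norm_num)]
  intro p hp
  obtain ⟨x, hx, rfl⟩ := Finset.mem_image.mp hp
  exact card_fiber_splitCubic hx
end

section
/- Let F be a finite field with q elements of characteristic 3. Then the number of monic cubics of the form X³ + aX + b over F (subleading coefficient 0) that are irreducible equals (q² − q)/3. -/
open Polynomial

/-- In characteristic `3`, the additive endomorphism `x ↦ x³ + a x`. -/
def cubeAddMulHom {F : Type*} [Field F] [CharP F 3] (a : F) : F →+ F where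
  toFun x := x ^ 3 + a * x
  map_zero' := by simp
  map_add' x y := by
    rw [add_pow_char]
    ring

theorem irreducible_cubic_iff_notMem_range {F : Type*} [Field F] [CharP F 3] (a b : F) :
    Irreducible (X ^ 3 + C a * X + C b : F[X]) ↔ b ∉ (cubeAddMulHom a).range := by
  have hdeg : (X ^ 3 + C a * X + C b : F[X]).natDegree = 3 := by compute_degree!
  have hne : (X ^ 3 + C a * X + C b : F[X]) ≠ 0 := by
    intro h
    simp [h] at hdeg
  rw [irreducible_iff_roots_eq_zero_of_degree_le_three (by lia) (by lia),
    Multiset.eq_zero_iff_forall_notMem, ← neg_mem_iff]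
  simp only [mem_roots hne, IsRoot.def, AddMonoidHom.mem_range, not_exists, cubeAddMulHom,
    AddMonoidHom.coe_mk, ZeroHom.coe_mk, eval_add, eval_mul, eval_pow, eval_X, eval_C,
    eq_neg_iff_add_eq_zero]

theorem mem_ker_cubeAddMulHom_iff {F : Type*} [Field F] [CharP F 3] {a s : F} (hs : s ≠ 0) :
    s ∈ (cubeAddMulHom a).ker ↔ a = -s ^ 2 := by
  change s ^ 3 + a * s = 0 ↔ _
  rw [show s ^ 3 + a * s = (a + s ^ 2) * s by ring, mul_eq_zero_iff_right hs,
    add_eq_zero_iff_eq_neg]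

theorem card_ker_cubeAddMulHom {F : Type*} [Field F] [CharP F 3] (a : F) :
    Nat.card (cubeAddMulHom a).ker = 1 ∨ Nat.card (cubeAddMulHom a).ker = 3 := by
  classical
  by_cases h : ∃ s ∈ (cubeAddMulHom a).ker, s ≠ 0
  · obtain ⟨s, hs, hs0⟩ := h
    right
    have ha := (mem_ker_cubeAddMulHom_iff hs0).1 hs
    have h3 : (3 : F) = 0 := CharP.cast_eq_zero F 3
    have hneg : s ≠ -s := fun h => hs0 (by linear_combination s * h3 - h)
    have hker : ((cubeAddMulHom a).ker : Set F) = ({0, s, -s} : Finset F) := by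
      ext t
      by_cases ht : t = 0
      · simp [ht]
      · rw [SetLike.mem_coe, mem_ker_cubeAddMulHom_iff ht, ha, neg_inj, eq_comm,
          sq_eq_sq_iff_eq_or_eq_neg]
        simp [ht]
    rw [← SetLike.coe_sort_coe, hker, Nat.card_coe_set_eq, Set.ncard_coe_finset,
      Finset.card_eq_three]
    exact ⟨0, s, -s, hs0.symm, by simpa [eq_comm] using hs0, hneg, rfl⟩
  · left
    push Not at h
    rw [AddSubgroup.card_eq_one, AddSubgroup.eq_bot_iff_forall]
    exact h

theorem three_mul_card_notMem_range {F : Type*} [Field F] [Finite F] [CharP F 3] (a : F) :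
    3 * Nat.card {b : F // b ∉ (cubeAddMulHom a).range} =
      Nat.card F * Nat.card {s : F // s ≠ 0 ∧ s ∈ (cubeAddMulHom a).ker} := by
  have hrange : Nat.card (cubeAddMulHom a).ker * Nat.card (cubeAddMulHom a).range =
      Nat.card F := by
    rw [← AddSubgroup.index_ker, AddSubgroup.card_mul_index]
  have hcompl : Nat.card (cubeAddMulHom a).range +
      Nat.card {b : F // b ∉ (cubeAddMulHom a).range} = Nat.card F :=
    Set.ncard_add_ncard_compl ((cubeAddMulHom a).range : Set F)
  have hker : Nat.card {s : F // s ≠ 0 ∧ s ∈ (cubeAddMulHom a).ker} + 1 =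
      Nat.card (cubeAddMulHom a).ker := by
    have h : {s : F | s ≠ 0 ∧ s ∈ (cubeAddMulHom a).ker} =
        ((cubeAddMulHom a).ker : Set F) \ {0} := by
      ext s
      simp [and_comm]
    have := Set.ncard_sdiff_singleton_add_one (zero_mem (cubeAddMulHom a).ker)
      (Set.toFinite ((cubeAddMulHom a).ker : Set F))
    rwa [← h] at this
  rcases card_ker_cubeAddMulHom a with h | h
  · rw [h] at hrange hker
    have : Nat.card {s : F // s ≠ 0 ∧ s ∈ (cubeAddMulHom a).ker} = 0 := by lia
    rw [this]
    lia
  · rw [h] at hrange hker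
    have : Nat.card {s : F // s ≠ 0 ∧ s ∈ (cubeAddMulHom a).ker} = 2 := by lia
    rw [this]
    lia

theorem card_irreducible_cubics_eq_sum {F : Type*} [Field F] [Fintype F] [CharP F 3] :
    Nat.card {p : F[X] // (∃ a b : F, p = X ^ 3 + C a * X + C b) ∧ Irreducible p} =
      ∑ a : F, Nat.card {b : F // b ∉ (cubeAddMulHom a).range} := by
  rw [← Nat.card_sigma]
  refine (Nat.card_congr (Equiv.ofBijective
    (fun x : (Σ a : F, {b : F // b ∉ (cubeAddMulHom a).range}) =>
      ⟨X ^ 3 + C x.1 * X + C x.2.1, ⟨x.1, x.2.1, rfl⟩,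
        (irreducible_cubic_iff_notMem_range _ _).2 x.2.2⟩) ⟨?_, ?_⟩)).symm
  · rintro ⟨a, b, hb⟩ ⟨a', b', hb'⟩ h
    have h := Subtype.ext_iff.1 h
    obtain rfl : a = a' := by simpa [coeff_X, coeff_C] using congrArg (coeff · 1) h
    obtain rfl : b = b' := by simpa using congrArg (coeff · 0) h
    rfl
  · rintro ⟨_, ⟨a, b, rfl⟩, hp⟩
    exact ⟨⟨a, b, (irreducible_cubic_iff_notMem_range a b).1 hp⟩, rfl⟩

theorem sum_card_ker_cubeAddMulHom {F : Type*} [Field F] [Fintype F] [CharP F 3] :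
    ∑ a : F, Nat.card {s : F // s ≠ 0 ∧ s ∈ (cubeAddMulHom a).ker} = Nat.card F - 1 := by
  rw [← Nat.card_sigma, ← Nat.card_units]
  refine Nat.card_congr (Equiv.trans (Equiv.ofBijective
    (fun x : (Σ a : F, {s : F // s ≠ 0 ∧ s ∈ (cubeAddMulHom a).ker}) =>
      (⟨x.2.1, x.2.2.1⟩ : {s : F // s ≠ 0})) ⟨?_, ?_⟩) unitsEquivNeZero.symm)
  · rintro ⟨a, s, hs, hsa⟩ ⟨a', s', hs', hsa'⟩ h
    obtain rfl : s = s' := Subtype.ext_iff.1 h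
    obtain rfl : a = a' := ((mem_ker_cubeAddMulHom_iff hs).1 hsa).trans
      ((mem_ker_cubeAddMulHom_iff hs).1 hsa').symm
    rfl
  · rintro ⟨s, hs⟩
    exact ⟨⟨-s ^ 2, s, hs, (mem_ker_cubeAddMulHom_iff hs).2 rfl⟩, rfl⟩

/-- Over a finite field `F` with `q` elements of characteristic `3`, the number of monic
cubics of the form `X³ + aX + b` (subleading coefficient `0`) that are irreducible is
`(q² - q)/3`. -/
theorem card_irreducible_traceless_cubics_char_three
    (F : Type*) [Field F] [Fintype F] [CharP F 3] :
    Nat.card {p : Polynomial F //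
        (∃ a b : F, p = X ^ 3 + C a * X + C b) ∧ Irreducible p} =
      (Fintype.card F ^ 2 - Fintype.card F) / 3 := by
  rw [card_irreducible_cubics_eq_sum]
  refine (Nat.div_eq_of_eq_mul_right three_pos ?_).symm
  simp_rw [Finset.mul_sum, three_mul_card_notMem_range]
  rw [← Finset.mul_sum, sum_card_ker_cubeAddMulHom, Nat.card_eq_fintype_card, Nat.mul_sub_one, sq]
end

section
/- Let F be a finite field with q elements of characteristic 3 and let c ∈ F with c ≠ 0. Then the number of monic cubics with subleading coefficient c over F that are irreducible equals q²/3. -/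
open Polynomial

theorem LinearMap.natCard_fiber_of_surjective {k V W : Type*} [Field k]
    [AddCommGroup V] [Module k V] [AddCommGroup W] [Module k W] [Module.Finite k V]
    (f : V →ₗ[k] W) (hf : Function.Surjective f) (w : W) :
    Nat.card {v : V // f v = w} =
      Nat.card k ^ (Module.finrank k V - Module.finrank k W) := by
  obtain ⟨v₀, rfl⟩ := hf w
  have e : {v : V // f v = f v₀} ≃ LinearMap.ker f :=
    (Equiv.subRight v₀).subtypeEquiv fun v => by simp [sub_eq_zero]
  have hrank := f.finrank_range_add_finrank_ker
  rw [LinearMap.range_eq_top.mpr hf, finrank_top] at hrank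
  rw [Nat.card_congr e, Module.natCard_eq_pow_finrank (K := k), ← hrank, Nat.add_sub_cancel_left]

theorem minpoly_of_finrank_eq_char_of_trace_ne_zero {F K : Type*} [Field F] [Field K] [Algebra F K]
    (p : ℕ) [Fact p.Prime] [CharP F p] (hK : Module.finrank F K = p) {x : K}
    (hx : Algebra.trace F K x ≠ 0) :
    (minpoly F x).natDegree = p ∧ (minpoly F x).nextCoeff = -Algebra.trace F K x := by
  have hp : p.Prime := Fact.out
  have : FiniteDimensional F K := Module.finite_of_finrank_pos (hK ▸ hp.pos)
  have htr := trace_eq_finrank_mul_minpoly_nextCoeff F x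
  have hmul := Module.finrank_mul_finrank F (IntermediateField.adjoin F {x}) K
  rw [hK, IntermediateField.adjoin.finrank (.of_finite F x)] at hmul
  rcases (Nat.dvd_prime hp).mp (Dvd.intro_left _ hmul) with h | h
  · rw [h, mul_one] at hmul
    exact ⟨hmul, by simp [htr, h]⟩
  · simp [htr, h] at hx

theorem Polynomial.exists_eq_monic_cubic_iff {R : Type*} [CommRing R] [Nontrivial R] (c : R)
    (p : R[X]) :
    (∃ a b : R, p = X ^ 3 + C c * X ^ 2 + C a * X + C b) ↔
      p.Monic ∧ p.natDegree = 3 ∧ p.nextCoeff = c := by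
  constructor
  · rintro ⟨a, b, rfl⟩
    have hdeg : (X ^ 3 + C c * X ^ 2 + C a * X + C b).natDegree = 3 := by compute_degree!
    refine ⟨by monicity!, hdeg, ?_⟩
    rw [nextCoeff_of_natDegree_pos (by lia), hdeg]
    simp
  · rintro ⟨hm, hdeg, hc⟩
    rw [nextCoeff_of_natDegree_pos (by lia), hdeg] at hc
    refine ⟨p.coeff 1, p.coeff 0, ?_⟩
    have h3 : p.coeff 3 = 1 := hdeg ▸ hm.coeff_natDegree
    conv_lhs => rw [p.as_sum_range_C_mul_X_pow, hdeg]
    simp only [Finset.sum_range_succ, Finset.sum_range_zero, h3, ← hc]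
    simp
    ring

theorem Irreducible.natCard_rootSet_of_natDegree_eq_finrank {F K : Type*} [Field F] [Finite F]
    [Field K] [Algebra F K] [FiniteDimensional F K] {p : F[X]} (hp : Irreducible p)
    (hdeg : p.natDegree = Module.finrank F K) :
    Nat.card (p.rootSet K) = Module.finrank F K := by
  have : Finite K := Module.finite_of_finite F
  have := Fintype.ofFinite K
  have := Fintype.ofFinite F
  have hdvd := hp.natDegree_dvd_iff_dvd_X_pow_card_pow_sub_X.mp hdeg.dvd
  rw [← Module.natCard_eq_pow_finrank, Nat.card_eq_fintype_card] at hdvd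
  have hsplit := (FiniteField.isSplittingField_sub K F).splits
  rw [← hdeg, Nat.card_eq_fintype_card]
  exact card_rootSet_eq_natDegree (PerfectField.separable_of_irreducible hp)
    (hsplit.of_dvd (map_ne_zero (FiniteField.X_pow_card_sub_X_ne_zero F Fintype.one_lt_card))
      (map_dvd (algebraMap F K) hdvd))

/-- Over a finite field `F` with `q` elements of characteristic `3`, for any `c ∈ F` with
`c ≠ 0` the number of irreducible monic cubics with subleading coefficient `c` is `q²/3`. -/
theorem card_irreducible_cubics_char_three_nonzero_trace
    (F : Type*) [Field F] [Fintype F] [CharP F 3] (c : F) (hc : c ≠ 0) :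
    Nat.card {p : Polynomial F //
        (∃ a b : F, p = X ^ 3 + C c * X ^ 2 + C a * X + C b) ∧ Irreducible p} =
      Fintype.card F ^ 2 / 3 := by
  have : Fact (Nat.Prime 3) := ⟨Nat.prime_three⟩
  let K := FiniteField.Extension F 3 3
  have hK : Module.finrank F K = 3 := FiniteField.finrank_extension F 3 3
  simp only [exists_eq_monic_cubic_iff]
  let S := {x : K // Algebra.trace F K x = -c}
  let T := {p : F[X] // (p.Monic ∧ p.natDegree = 3 ∧ p.nextCoeff = c) ∧ Irreducible p}
  have hS : Nat.card S = Fintype.card F ^ 2 := by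
    rw [LinearMap.natCard_fiber_of_surjective _ (Algebra.trace_surjective F K), hK,
      Module.finrank_self, Nat.card_eq_fintype_card]
  have hint (x : K) : IsIntegral F x := .of_finite F x
  have hmin (x : S) : (minpoly F x.1).natDegree = 3 ∧ (minpoly F x.1).nextCoeff = c := by
    simpa [x.2] using minpoly_of_finrank_eq_char_of_trace_ne_zero 3 hK (x := x.1)
      (by simpa [x.2] using hc)
  let f (x : S) : T :=
    ⟨minpoly F x.1, ⟨minpoly.monic (hint _), hmin x⟩, minpoly.irreducible (hint _)⟩
  have hfiber (p : T) : Nat.card {x : S // f x = p} = 3 := by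
    obtain ⟨p, ⟨hm, hdeg, hnext⟩, hirr⟩ := p
    have hroot (x : K) : x ∈ p.rootSet K ↔ minpoly F x = p := by
      rw [mem_rootSet_of_ne hirr.ne_zero]
      exact ⟨fun h => (minpoly.eq_of_irreducible_of_monic hirr h hm).symm,
        fun h => h ▸ minpoly.aeval F x⟩
    have htrace (x : K) (hx : minpoly F x = p) : Algebra.trace F K x = -c := by
      have hmul := Module.finrank_mul_finrank F (IntermediateField.adjoin F {x}) K
      rw [hK, IntermediateField.adjoin.finrank (hint x), hx, hdeg] at hmul
      rw [trace_eq_finrank_mul_minpoly_nextCoeff, hx, hnext,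
        show Module.finrank (IntermediateField.adjoin F {x}) K = 1 by lia, Nat.cast_one, one_mul]
    refine .trans ?_ <|
      (hirr.natCard_rootSet_of_natDegree_eq_finrank (hdeg.trans hK.symm)).trans hK
    exact Nat.card_congr
      { toFun x := ⟨x.1.1, (hroot _).mpr (congrArg Subtype.val x.2)⟩
        invFun x := ⟨⟨x.1, htrace _ ((hroot _).mp x.2)⟩, Subtype.ext ((hroot _).mp x.2)⟩
        left_inv _ := rfl
        right_inv _ := rfl }
  have hf : Function.Surjective f := fun p => by
    have : Nonempty {x : S // f x = p} := (Nat.card_pos_iff.mp (by simp [hfiber])).1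
    exact this.elim fun x => ⟨x.1, x.2⟩
  have : Finite T := .of_surjective f hf
  have := Fintype.ofFinite T
  have hcount : Nat.card S = Nat.card T * 3 := by
    rw [← Nat.card_congr (Equiv.sigmaFiberEquiv f), Nat.card_sigma]
    simp [hfiber]
  exact (Nat.div_eq_of_eq_mul_left (by norm_num) (hS.symm.trans hcount)).symm
end

section
/- For every integer d ≥ 2, the product over all odd primes p of (1 + 1/(p^{3d} − p^{d})) is at most 1 + (2^d − 2)/(2^{2d} − 2^d + 1). -/
/-- A telescoping bound for the partial products of `1 + c / (n ^ 4 - 1)` over `n ≥ 3`. -/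
theorem prod_Ioc_one_add_div_le {c : ℝ} (hc₀ : 0 ≤ c) (hc₁ : c ≤ 1) {N : ℕ} (hN : 2 ≤ N) :
    ∏ n ∈ Finset.Ioc 2 N, (1 + c / ((n : ℝ) ^ 4 - 1)) ≤ 1 + c * (1 / 2 - 1 / N) := by
  induction N, hN using Nat.le_induction with
  | base => simp
  | succ N hN ih =>
    have hx : (2 : ℝ) ≤ N := by exact_mod_cast hN
    have hb : 0 < ((N : ℝ) + 1) ^ 4 - 1 := by
      have : 1 < ((N : ℝ) + 1) ^ 4 := one_lt_pow₀ (by linarith) (by norm_num)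
      linarith
    rw [Finset.prod_Ioc_succ_top (by omega)]
    push_cast
    refine (mul_le_mul_of_nonneg_right ih (by positivity)).trans ?_
    have hle : 2 / (((N : ℝ) + 1) ^ 4 - 1) ≤ 1 / N - 1 / (N + 1) := by
      rw [div_sub_div _ _ (by positivity) (by positivity), div_le_div_iff₀ hb (by positivity)]
      have : 0 ≤ (N : ℝ) ^ 4 := by positivity
      have : 0 ≤ (N : ℝ) ^ 3 := by positivity
      nlinarith
    have hfac : 1 + c * (1 / 2 - 1 / (N : ℝ)) ≤ 2 := by
      have : 0 ≤ 1 / (N : ℝ) := by positivity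
      nlinarith
    have hmul := mul_le_mul_of_nonneg_right hfac (by positivity : 0 ≤ c / (((N : ℝ) + 1) ^ 4 - 1))
    have hc := mul_le_mul_of_nonneg_left hle hc₀
    have : c * (2 / (((N : ℝ) + 1) ^ 4 - 1)) = 2 * (c / (((N : ℝ) + 1) ^ 4 - 1)) := by ring
    linarith

/-- Partial products of `1 + c / (n ^ 4 - 1)` over integers `n ≥ 3` are at most `1 + c / 2`. -/
theorem prod_one_add_div_le {c : ℝ} (hc₀ : 0 ≤ c) (hc₁ : c ≤ 1) (t : Finset ℕ)
    (ht : ∀ n ∈ t, 3 ≤ n) :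
    ∏ n ∈ t, (1 + c / ((n : ℝ) ^ 4 - 1)) ≤ 1 + c / 2 := by
  have hsub : t ⊆ Finset.Ioc 2 (t.sup id + 2) := fun n hn ↦ by
    have := ht n hn
    have : n ≤ t.sup id := Finset.le_sup (f := id) hn
    simp only [Finset.mem_Ioc]
    omega
  have hpos : ∀ n ∈ Finset.Ioc 2 (t.sup id + 2), 0 ≤ c / ((n : ℝ) ^ 4 - 1) := fun n hn ↦ by
    have hn : (1 : ℝ) ≤ n := by exact_mod_cast (by simp at hn; omega : 1 ≤ n)
    exact div_nonneg hc₀ (sub_nonneg.2 (one_le_pow₀ hn))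
  calc ∏ n ∈ t, (1 + c / ((n : ℝ) ^ 4 - 1))
      = ∏ n ∈ Finset.Ioc 2 (t.sup id + 2),
          if n ∈ t then 1 + c / ((n : ℝ) ^ 4 - 1) else 1 := by
        rw [Finset.prod_ite_mem, Finset.inter_eq_right.2 hsub]
    _ ≤ ∏ n ∈ Finset.Ioc 2 (t.sup id + 2), (1 + c / ((n : ℝ) ^ 4 - 1)) := by
        refine Finset.prod_le_prod (fun n hn ↦ ?_) (fun n hn ↦ ?_) <;>
        · have := hpos n hn
          split_ifs <;> linarith
    _ ≤ 1 + c * (1 / 2 - 1 / (t.sup id + 2 : ℕ)) :=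
        prod_Ioc_one_add_div_le hc₀ hc₁ (by omega)
    _ ≤ 1 + c / 2 := by
        have : 0 ≤ c * (1 / (t.sup id + 2 : ℕ)) := by positivity
        linarith

/-- The terms `1 / (n ^ (3 * d) - n ^ d)` are dominated by `2⁻ᵈ / (n ^ 4 - 1)`. -/
theorem one_div_pow_sub_pow_le {d n : ℕ} (hd : 2 ≤ d) (hn : 3 ≤ n) :
    1 / ((n : ℝ) ^ (3 * d) - (n : ℝ) ^ d) ≤ (1 / 2 ^ d) / ((n : ℝ) ^ 4 - 1) := by
  have hn' : (3 : ℝ) ≤ n := by exact_mod_cast hn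
  have h4 : 1 < (n : ℝ) ^ 4 := one_lt_pow₀ (by linarith) (by norm_num)
  have hpow : (n : ℝ) ^ 4 ≤ (n : ℝ) ^ (2 * d) := pow_le_pow_right₀ (by linarith) (by omega)
  have h2 : (2 : ℝ) ^ d ≤ (n : ℝ) ^ d := pow_le_pow_left₀ (by norm_num) (by linarith) d
  rw [div_div]
  refine one_div_le_one_div_of_le (mul_pos (by positivity) (by linarith)) ?_
  calc (2 : ℝ) ^ d * ((n : ℝ) ^ 4 - 1) ≤ (n : ℝ) ^ d * ((n : ℝ) ^ (2 * d) - 1) :=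
        mul_le_mul h2 (by linarith) (by linarith) (by positivity)
    _ = (n : ℝ) ^ (3 * d) - (n : ℝ) ^ d := by ring

/-- For every integer `d ≥ 2`, the product over all odd primes `p` of
`1 + 1/(p^{3d} - p^d)` is at most `1 + (2^d - 2)/(2^{2d} - 2^d + 1)`. -/
theorem tprod_odd_primes_le (d : ℕ) (hd : 2 ≤ d) :
    (∏' p : {p : ℕ // p.Prime ∧ Odd p},
        (1 + 1 / (((p : ℕ) : ℝ) ^ (3 * d) - ((p : ℕ) : ℝ) ^ d))) ≤
      1 + ((2 : ℝ) ^ d - 2) / ((2 : ℝ) ^ (2 * d) - 2 ^ d + 1) := by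
  have hx : (4 : ℝ) ≤ 2 ^ d :=
    le_of_eq_of_le (by norm_num) (pow_le_pow_right₀ (by norm_num : (1 : ℝ) ≤ 2) hd)
  have hc₁ : 1 / (2 : ℝ) ^ d ≤ 1 := by
    rw [div_le_one (by positivity)]
    linarith
  have hthree (p : {p : ℕ // p.Prime ∧ Odd p}) : 3 ≤ (p : ℕ) := by
    obtain ⟨p, hp, k, rfl⟩ := p
    have := hp.two_le
    dsimp only
    omega
  have hnonneg (p : {p : ℕ // p.Prime ∧ Odd p}) :
      0 ≤ 1 / (((p : ℕ) : ℝ) ^ (3 * d) - ((p : ℕ) : ℝ) ^ d) := by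
    have hp : (1 : ℝ) ≤ (p : ℕ) := by exact_mod_cast (hthree p).trans' (by norm_num)
    exact one_div_nonneg.2 (sub_nonneg.2 (pow_le_pow_right₀ hp (by omega)))
  have hsum : Summable fun p : {p : ℕ // p.Prime ∧ Odd p} ↦
      1 / (((p : ℕ) : ℝ) ^ (3 * d) - ((p : ℕ) : ℝ) ^ d) := by
    refine .of_nonneg_of_le hnonneg (fun p ↦ ?_)
      ((Real.summable_one_div_nat_pow.2 one_lt_two).comp_injective Subtype.val_injective)
    have hp : (3 : ℝ) ≤ (p : ℕ) := by exact_mod_cast hthree p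
    have hsq : ((p : ℕ) : ℝ) ^ 2 ≤ ((p : ℕ) : ℝ) ^ 4 - 1 := by
      nlinarith [sq_nonneg (((p : ℕ) : ℝ) ^ 2 - 2)]
    refine (one_div_pow_sub_pow_le hd (hthree p)).trans ?_
    exact div_le_div₀ zero_le_one hc₁ (by positivity) hsq
  have hprod := (Real.multipliable_one_add_of_summable hsum).hasProd
  have hbound : 1 + 1 / (2 : ℝ) ^ d / 2 ≤
      1 + ((2 : ℝ) ^ d - 2) / ((2 : ℝ) ^ (2 * d) - 2 ^ d + 1) := by
    rw [pow_mul', div_div]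
    gcongr 1 + ?_
    rw [div_le_div_iff₀ (by positivity) (by nlinarith)]
    nlinarith
  refine (le_of_tendsto' hprod fun s ↦ ?_).trans hbound
  calc _ ≤ ∏ p ∈ s, (1 + 1 / (2 : ℝ) ^ d / (((p : ℕ) : ℝ) ^ 4 - 1)) :=
        Finset.prod_le_prod (fun p _ ↦ by linarith [hnonneg p])
          (fun p _ ↦ by linarith [one_div_pow_sub_pow_le hd (hthree p)])
    _ = ∏ n ∈ s.map (.subtype _), (1 + 1 / (2 : ℝ) ^ d / ((n : ℝ) ^ 4 - 1)) := by
        simp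
    _ ≤ 1 + 1 / (2 : ℝ) ^ d / 2 := by
        refine prod_one_add_div_le (by positivity) hc₁ _ fun n hn ↦ ?_
        obtain ⟨p, -, rfl⟩ := Finset.mem_map.1 hn
        exact hthree p
end

section
/- For every integer d ≥ 2, the product over all odd primes p of (1 − 1/(p^{3d} + p^{d})) is at least 1 − (2^d − 2)/(2^{2d} + 2^d − 1). -/
theorem one_sub_sum_le_prod_one_sub {ι : Type*} (s : Finset ι) (f : ι → ℝ)
    (h0 : ∀ i ∈ s, 0 ≤ f i) (h1 : ∀ i ∈ s, f i ≤ 1) :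
    1 - ∑ i ∈ s, f i ≤ ∏ i ∈ s, (1 - f i) := by
  induction s using Finset.cons_induction with
  | empty => simp
  | cons a s ha ih =>
    rw [Finset.forall_mem_cons] at h0 h1
    rw [Finset.sum_cons, Finset.prod_cons]
    have hsum : 0 ≤ ∑ i ∈ s, f i := Finset.sum_nonneg h0.2
    nlinarith [mul_le_mul_of_nonneg_left (ih h0.2 h1.2) (sub_nonneg.2 h1.1),
      mul_nonneg h0.1 hsum]

/-- The sum of `1 / n²` over finitely many distinct `n ≥ 3` is at most `1 / 2`. -/
theorem sum_inv_sq_le_half (s : Finset ℕ) (hs : ∀ n ∈ s, 3 ≤ n) :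
    ∑ n ∈ s, ((n : ℝ) ^ 2)⁻¹ ≤ 1 / 2 := by
  have hsub : s ⊆ Finset.Ioc 2 (max 2 (s.sup id)) := fun n hn =>
    Finset.mem_Ioc.2 ⟨hs n hn, le_max_of_le_right (Finset.le_sup (f := id) hn)⟩
  calc ∑ n ∈ s, ((n : ℝ) ^ 2)⁻¹
      ≤ ∑ n ∈ Finset.Ioc 2 (max 2 (s.sup id)), ((n : ℝ) ^ 2)⁻¹ :=
        Finset.sum_le_sum_of_subset_of_nonneg hsub fun _ _ _ => by positivity
    _ ≤ ((2 : ℕ) : ℝ)⁻¹ - ((max 2 (s.sup id) : ℕ) : ℝ)⁻¹ :=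
        sum_Ioc_inv_sq_le_sub two_ne_zero (le_max_left _ _)
    _ ≤ 1 / 2 := by
        have : 0 ≤ ((max 2 (s.sup id) : ℕ) : ℝ)⁻¹ := by positivity
        norm_num at this ⊢

theorem one_div_pow_add_pow_le (d : ℕ) (hd : 1 ≤ d) (x : ℝ) (hx : 3 ≤ x) :
    1 / (x ^ (3 * d) + x ^ d) ≤ 9 / 27 ^ d * (x ^ 2)⁻¹ := by
  obtain ⟨e, rfl⟩ := Nat.exists_eq_add_of_le' hd
  have hx0 : 0 < x := by linarith
  have h27 : (27 : ℝ) ^ e ≤ (x ^ 3) ^ e := by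
    gcongr
    calc (27 : ℝ) = 3 ^ 3 := by norm_num
      _ ≤ x ^ 3 := by gcongr
  have hpow : x ^ (3 * (e + 1)) = (x ^ 3) ^ e * x ^ 3 := by rw [pow_mul, pow_succ]
  rw [← div_eq_mul_inv, div_div, div_le_div_iff₀ (by positivity) (by positivity), hpow]
  calc 1 * (27 ^ (e + 1) * x ^ 2) = 9 * (27 ^ e * (3 * x ^ 2)) := by ring
    _ ≤ 9 * ((x ^ 3) ^ e * (x * x ^ 2)) := by gcongr
    _ ≤ 9 * ((x ^ 3) ^ e * x ^ 3 + x ^ (e + 1)) := by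
        have : 0 < x ^ (e + 1) := by positivity
        nlinarith

theorem nine_div_two_mul_le (d : ℕ) (hd : 2 ≤ d) :
    9 / (27 : ℝ) ^ d * (1 / 2) ≤
      ((2 : ℝ) ^ d - 2) / ((2 : ℝ) ^ (2 * d) + 2 ^ d - 1) := by
  have h2 : (4 : ℝ) ≤ 2 ^ d := by
    calc (4 : ℝ) = 2 ^ 2 := by norm_num
      _ ≤ 2 ^ d := pow_le_pow_right₀ (by norm_num) hd
  have h27 : 27 / 2 * (2 : ℝ) ^ d ≤ 27 ^ d := by
    calc 27 / 2 * (2 : ℝ) ^ d ≤ (27 / 2) ^ d * 2 ^ d := by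
          gcongr
          exact le_self_pow₀ (by norm_num) (by omega)
      _ = 27 ^ d := by rw [← mul_pow]; norm_num
  have hsq : (2 : ℝ) ^ (2 * d) = (2 ^ d) ^ 2 := by rw [mul_comm, pow_mul]
  rw [hsq]
  generalize (2 : ℝ) ^ d = x at *
  calc 9 / (27 : ℝ) ^ d * (1 / 2) ≤ 9 / (27 / 2 * x) * (1 / 2) := by gcongr
    _ = 1 / (3 * x) := by field_simp; norm_num
    _ ≤ (x - 2) / (x ^ 2 + x - 1) := by
        rw [div_le_div_iff₀ (by positivity) (by nlinarith)]
        nlinarith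

/-- For every integer `d ≥ 2`, the product over all odd primes `p` of
`1 - 1/(p^{3d} + p^d)` is at least `1 - (2^d - 2)/(2^{2d} + 2^d - 1)`. -/
theorem tprod_odd_primes_ge (d : ℕ) (hd : 2 ≤ d) :
    1 - ((2 : ℝ) ^ d - 2) / ((2 : ℝ) ^ (2 * d) + 2 ^ d - 1) ≤
      ∏' p : {p : ℕ // p.Prime ∧ Odd p},
        (1 - 1 / (((p : ℕ) : ℝ) ^ (3 * d) + ((p : ℕ) : ℝ) ^ d)) := by
  have three_le (p : {p : ℕ // p.Prime ∧ Odd p}) : 3 ≤ (p : ℕ) := by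
    obtain ⟨p, hp, k, hk⟩ := p
    have := hp.two_le
    simp only
    omega
  have three_le_cast (p : {p : ℕ // p.Prime ∧ Odd p}) : (3 : ℝ) ≤ (p : ℕ) := by
    exact_mod_cast three_le p
  have hpartial (s : Finset {p : ℕ // p.Prime ∧ Odd p}) :
      1 - ((2 : ℝ) ^ d - 2) / ((2 : ℝ) ^ (2 * d) + 2 ^ d - 1) ≤
        ∏ p ∈ s, (1 - 1 / (((p : ℕ) : ℝ) ^ (3 * d) + ((p : ℕ) : ℝ) ^ d)) := by
    have hsum : ∑ p ∈ s, 1 / (((p : ℕ) : ℝ) ^ (3 * d) + ((p : ℕ) : ℝ) ^ d) ≤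
        9 / 27 ^ d * (1 / 2) := by
      calc ∑ p ∈ s, 1 / (((p : ℕ) : ℝ) ^ (3 * d) + ((p : ℕ) : ℝ) ^ d)
          ≤ ∑ p ∈ s, 9 / 27 ^ d * (((p : ℕ) : ℝ) ^ 2)⁻¹ :=
            Finset.sum_le_sum fun p _ =>
              one_div_pow_add_pow_le d (by omega) _ (three_le_cast p)
        _ = 9 / 27 ^ d * ∑ n ∈ s.map (Function.Embedding.subtype _), ((n : ℝ) ^ 2)⁻¹ := by
            rw [← Finset.mul_sum, Finset.sum_map]
            rfl
        _ ≤ 9 / 27 ^ d * (1 / 2) := by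
            gcongr
            refine sum_inv_sq_le_half _ fun n hn => ?_
            obtain ⟨p, -, rfl⟩ := Finset.mem_map.1 hn
            exact three_le p
    have hprod := one_sub_sum_le_prod_one_sub s
      (fun p => 1 / (((p : ℕ) : ℝ) ^ (3 * d) + ((p : ℕ) : ℝ) ^ d))
      (fun p _ => by positivity) fun p _ => by
        have h1 : (1 : ℝ) ≤ (p : ℕ) ^ d := one_le_pow₀ (by linarith [three_le_cast p])
        have h2 : (0 : ℝ) ≤ (p : ℕ) ^ (3 * d) := by positivity
        exact div_le_one_of_le₀ (by linarith) (by linarith)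
    linarith [nine_div_two_mul_le d hd]
  by_cases h : Multipliable fun p : {p : ℕ // p.Prime ∧ Odd p} =>
      (1 - 1 / (((p : ℕ) : ℝ) ^ (3 * d) + ((p : ℕ) : ℝ) ^ d))
  · exact ge_of_tendsto' h.hasProd hpartial
  · rw [tprod_eq_one_of_not_multipliable h]
    simpa using hpartial ∅
end

section
/- For every integer d ≥ 2, one has (1 − 2^{−d} + 2^{−2d}) · ∏_{p odd prime} (1 − p^{−2d} + p^{−3d}) ≤ 1/ζ(2d), where the product runs over all odd primes p and ζ is the Riemann zeta function. -/
open Filter Finset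

/-- The local density factor at an odd prime is within a factor `1 + 2x/n^4` of the Euler factor. -/
lemma one_sub_add_le_mul_one_sub {d n : ℕ} (hd : 2 ≤ d) (hn : 3 ≤ n) :
    1 - 1 / (n : ℝ) ^ (2 * d) + 1 / (n : ℝ) ^ (3 * d) ≤
      (1 + 1 / (2 : ℝ) ^ d * (2 / (n : ℝ) ^ 4)) * (1 - 1 / (n : ℝ) ^ (2 * d)) := by
  have hn' : (3 : ℝ) ≤ n := by exact_mod_cast hn
  obtain ⟨y, hy⟩ : ∃ y : ℝ, y = 1 / (n : ℝ) ^ d := ⟨_, rfl⟩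
  have hy0 : 0 ≤ y := by rw [hy]; positivity
  have hyx : y ≤ 1 / (2 : ℝ) ^ d := by
    rw [hy]
    gcongr
    linarith
  have hyn : y ^ 2 ≤ 1 / (n : ℝ) ^ 4 := by
    rw [hy, div_pow, one_pow, ← pow_mul]
    gcongr
    · linarith
    · omega
  have hn4 : 1 / (n : ℝ) ^ 4 ≤ 1 / 2 := by
    gcongr
    calc (2 : ℝ) ≤ 3 ^ 4 := by norm_num
      _ ≤ (n : ℝ) ^ 4 := by gcongr
  have h2 : 1 / (n : ℝ) ^ (2 * d) = y ^ 2 := by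
    rw [hy, div_pow, one_pow, ← pow_mul, mul_comm]
  have h3 : 1 / (n : ℝ) ^ (3 * d) = y ^ 3 := by
    rw [hy, div_pow, one_pow, ← pow_mul, mul_comm]
  rw [h2, h3, show (2 : ℝ) / (n : ℝ) ^ 4 = 2 * (1 / (n : ℝ) ^ 4) by ring]
  have h5 : y ^ 3 ≤ 1 / (2 : ℝ) ^ d * (1 / (n : ℝ) ^ 4) := by
    rw [pow_succ']
    gcongr
  have h6 : 0 ≤ 1 / (2 : ℝ) ^ d * (1 / (n : ℝ) ^ 4) := by positivity
  nlinarith [mul_nonneg h6 (sub_nonneg.2 (hyn.trans hn4))]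

lemma one_div_two_pow_le {d : ℕ} (hd : 2 ≤ d) : (1 : ℝ) / 2 ^ d ≤ 1 / 4 := by
  rw [show (4 : ℝ) = 2 ^ 2 by norm_num]
  gcongr
  norm_num

lemma one_sub_one_div_pow_nonneg (n k : ℕ) : 0 ≤ 1 - 1 / (n : ℝ) ^ k := by
  rcases n.eq_zero_or_pos with rfl | hn
  · rcases k.eq_zero_or_pos with rfl | hk
    · simp
    · simp [hk.ne']
  · have : (1 : ℝ) ≤ (n : ℝ) ^ k := one_le_pow₀ (by exact_mod_cast hn)
    rw [sub_nonneg]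
    exact div_le_one_of_le₀ this (by positivity)

lemma prod_local_density_le {d n : ℕ} (hd : 2 ≤ d) (hn : 3 ≤ n) :
    ∏ p ∈ range n with p.Prime ∧ Odd p,
        (1 - 1 / (p : ℝ) ^ (2 * d) + 1 / (p : ℝ) ^ (3 * d)) ≤
      (1 + 1 / (2 : ℝ) ^ d * (1 / 2 - 1 / n)) *
        ∏ p ∈ range n with p.Prime ∧ Odd p, (1 - 1 / (p : ℝ) ^ (2 * d)) := by
  have hx0 : (0 : ℝ) < 1 / 2 ^ d := by positivity
  have hx := one_div_two_pow_le hd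
  induction n, hn using Nat.le_induction with
  | base =>
    have : (range 3).filter (fun p ↦ p.Prime ∧ Odd p) = ∅ := by decide
    rw [this]
    simp only [prod_empty, Nat.cast_ofNat]
    linarith
  | succ n hn ih =>
    have hn' : (3 : ℝ) ≤ n := by exact_mod_cast hn
    have hG : 0 ≤ ∏ p ∈ range n with p.Prime ∧ Odd p, (1 - 1 / (p : ℝ) ^ (2 * d)) :=
      prod_nonneg fun p _ ↦ one_sub_one_div_pow_nonneg p _
    have hb : 0 ≤ 1 / 2 - 1 / (n : ℝ) := by
      rw [sub_nonneg]
      gcongr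
      linarith
    rw [range_add_one, filter_insert]
    split_ifs with hp
    · rw [prod_insert (by simp), prod_insert (by simp)]
      have hg := one_sub_one_div_pow_nonneg n (2 * d)
      have hstep : (1 + 1 / (2 : ℝ) ^ d * (2 / (n : ℝ) ^ 4)) *
          (1 + 1 / (2 : ℝ) ^ d * (1 / 2 - 1 / n)) ≤
          1 + 1 / (2 : ℝ) ^ d * (1 / 2 - 1 / (n + 1 : ℕ)) := by
        have h1 : 2 / (n : ℝ) ^ 4 * (9 / 8) ≤ 1 / n - 1 / (n + 1 : ℕ) := by
          push_cast
          rw [div_sub_div _ _ (by positivity) (by positivity), div_mul_div_comm,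
            div_le_div_iff₀ (by positivity) (by positivity)]
          have : 9 * ((n : ℝ) + 1) ≤ 4 * (n : ℝ) ^ 3 := by nlinarith [mul_self_nonneg (n : ℝ)]
          nlinarith [mul_le_mul_of_nonneg_left this (by positivity : (0 : ℝ) ≤ 2 * n)]
        have h2 : 1 / (2 : ℝ) ^ d * (1 / 2 - 1 / n) ≤ 1 / 8 := by
          have : (0 : ℝ) ≤ 1 / n := by positivity
          nlinarith
        have h3 : (0 : ℝ) ≤ 2 / (n : ℝ) ^ 4 := by positivity
        nlinarith [mul_le_mul_of_nonneg_left h1 hx0.le,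
          mul_le_mul_of_nonneg_left h2 (mul_nonneg hx0.le h3)]
      calc _ ≤ ((1 + 1 / (2 : ℝ) ^ d * (2 / (n : ℝ) ^ 4)) * (1 - 1 / (n : ℝ) ^ (2 * d))) *
            ((1 + 1 / (2 : ℝ) ^ d * (1 / 2 - 1 / n)) *
              ∏ p ∈ range n with p.Prime ∧ Odd p, (1 - 1 / (p : ℝ) ^ (2 * d))) := by
            refine mul_le_mul (one_sub_add_le_mul_one_sub hd hn) ih ?_ (by positivity)
            exact prod_nonneg fun p _ ↦
              add_nonneg (one_sub_one_div_pow_nonneg p _) (by positivity)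
        _ = ((1 + 1 / (2 : ℝ) ^ d * (2 / (n : ℝ) ^ 4)) *
            (1 + 1 / (2 : ℝ) ^ d * (1 / 2 - 1 / n))) * ((1 - 1 / (n : ℝ) ^ (2 * d)) *
              ∏ p ∈ range n with p.Prime ∧ Odd p, (1 - 1 / (p : ℝ) ^ (2 * d))) := by ring
        _ ≤ _ := by gcongr
    · refine ih.trans ?_
      gcongr
      linarith

/-- The finite form of the inequality, with all primes below `n` in place of all primes. -/
lemma mul_prod_local_density_le {d n : ℕ} (hd : 2 ≤ d) (hn : 3 ≤ n) :
    (1 - 1 / (2 : ℝ) ^ d + 1 / (2 : ℝ) ^ (2 * d)) *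
        ∏ p ∈ range n with p.Prime ∧ Odd p,
          (1 - 1 / (p : ℝ) ^ (2 * d) + 1 / (p : ℝ) ^ (3 * d)) ≤
      ∏ p ∈ n.primesBelow, (1 - 1 / (p : ℝ) ^ (2 * d)) := by
  have hsplit : n.primesBelow = insert 2 ((range n).filter fun p ↦ p.Prime ∧ Odd p) := by
    ext p
    simp only [Nat.mem_primesBelow, mem_insert, mem_filter, mem_range]
    constructor
    · rintro ⟨h, hp⟩
      exact hp.eq_two_or_odd'.imp_right fun ho ↦ ⟨h, hp, ho⟩
    · rintro (rfl | ⟨h, hp, -⟩)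
      · exact ⟨hn, Nat.prime_two⟩
      · exact ⟨h, hp⟩
  rw [hsplit, prod_insert (by simp)]
  have hG : 0 ≤ ∏ p ∈ range n with p.Prime ∧ Odd p, (1 - 1 / (p : ℝ) ^ (2 * d)) :=
    prod_nonneg fun p _ ↦ one_sub_one_div_pow_nonneg p _
  have h := prod_local_density_le hd hn
  have hx0 : (0 : ℝ) < 1 / 2 ^ d := by positivity
  have hx := one_div_two_pow_le hd
  have h2 : 1 / (2 : ℝ) ^ (2 * d) = (1 / 2 ^ d) ^ 2 := by
    rw [div_pow, one_pow, ← pow_mul, mul_comm]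
  rw [Nat.cast_ofNat, h2]
  generalize 1 / (2 : ℝ) ^ d = x at *
  have hq : 0 ≤ 1 - x + x ^ 2 := by nlinarith
  have hn0 : (0 : ℝ) ≤ 1 / n := by positivity
  calc _ ≤ (1 - x + x ^ 2) * ((1 + x * (1 / 2 - 1 / n)) *
        ∏ p ∈ range n with p.Prime ∧ Odd p, (1 - 1 / (p : ℝ) ^ (2 * d))) := by gcongr
    _ ≤ (1 - x + x ^ 2) * ((1 + x * (1 / 2)) *
        ∏ p ∈ range n with p.Prime ∧ Odd p, (1 - 1 / (p : ℝ) ^ (2 * d))) := by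
      gcongr
      linarith
    _ = ((1 - x + x ^ 2) * (1 + x * (1 / 2))) *
        ∏ p ∈ range n with p.Prime ∧ Odd p, (1 - 1 / (p : ℝ) ^ (2 * d)) := by ring
    _ ≤ _ := by
      gcongr
      nlinarith [mul_nonneg hx0.le (sub_nonneg.2 hx),
        mul_nonneg (mul_nonneg hx0.le hx0.le) (sub_nonneg.2 hx)]

lemma tendsto_prod_primesBelow_inv_riemannZeta_re {k : ℕ} (hk : 1 < k) :
    Tendsto (fun n : ℕ ↦ ∏ p ∈ n.primesBelow, (1 - 1 / (p : ℝ) ^ k)) atTop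
      (nhds (1 / (riemannZeta (k : ℂ)).re)) := by
  have hs : 1 < (k : ℂ).re := by simpa using hk
  have hterm (n : ℕ) : ∏ p ∈ n.primesBelow, (1 - (p : ℂ) ^ (-(k : ℂ)))⁻¹ =
      (((∏ p ∈ n.primesBelow, (1 - 1 / (p : ℝ) ^ k))⁻¹ : ℝ) : ℂ) := by
    rw [← prod_inv_distrib]
    push_cast
    refine prod_congr rfl fun p _ ↦ ?_
    rw [Complex.cpow_neg, Complex.cpow_natCast, one_div]
  have h := riemannZeta_eulerProduct hs
  simp only [hterm] at h
  have hre := (Complex.continuous_re.tendsto _).comp h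
  simp only [Function.comp_def, Complex.ofReal_re] at hre
  have hne : (riemannZeta (k : ℂ)).re ≠ 0 := by
    intro h0
    have him := (Complex.continuous_im.tendsto _).comp h
    simp only [Function.comp_def, Complex.ofReal_im] at him
    have him0 := tendsto_nhds_unique him tendsto_const_nhds
    exact riemannZeta_ne_zero_of_one_lt_re hs (Complex.ext h0 him0)
  simpa using hre.inv₀ hne

lemma multipliable_local_density {d : ℕ} (hd : 2 ≤ d) :
    Multipliable fun p : {p : ℕ // p.Prime ∧ Odd p} ↦
      (1 - 1 / ((p : ℕ) : ℝ) ^ (2 * d) + 1 / ((p : ℕ) : ℝ) ^ (3 * d)) := by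
  have h (k : ℕ) (hk : 1 < k) :
      Summable fun p : {p : ℕ // p.Prime ∧ Odd p} ↦ 1 / ((p : ℕ) : ℝ) ^ k :=
    (Real.summable_one_div_nat_pow.2 hk).subtype _
  have hs := (h (3 * d) (by omega)).sub (h (2 * d) (by omega))
  refine (multipliable_one_add_of_summable hs.norm).congr fun p ↦ ?_
  ring

lemma tprod_local_density_le_prod {d : ℕ} (hd : 2 ≤ d) (n : ℕ) :
    ∏' p : {p : ℕ // p.Prime ∧ Odd p},
        (1 - 1 / ((p : ℕ) : ℝ) ^ (2 * d) + 1 / ((p : ℕ) : ℝ) ^ (3 * d)) ≤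
      ∏ p ∈ range n with p.Prime ∧ Odd p,
        (1 - 1 / (p : ℝ) ^ (2 * d) + 1 / (p : ℝ) ^ (3 * d)) := by
  rw [← prod_subtype_eq_prod_filter]
  refine le_of_tendsto (multipliable_local_density hd).hasProd ?_
  filter_upwards [eventually_ge_atTop ((range n).subtype fun p ↦ p.Prime ∧ Odd p)] with T hT
  rw [← prod_sdiff hT]
  have h0 (p : ℕ) : 0 ≤ 1 - 1 / (p : ℝ) ^ (2 * d) + 1 / (p : ℝ) ^ (3 * d) :=
    add_nonneg (one_sub_one_div_pow_nonneg p _) (by positivity)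
  refine mul_le_of_le_one_left (prod_nonneg fun p _ ↦ h0 p) (prod_le_one (fun p _ ↦ h0 p) ?_)
  intro p _
  have hp : (1 : ℝ) ≤ (p : ℕ) := by exact_mod_cast p.2.1.one_le
  have : 1 / ((p : ℕ) : ℝ) ^ (3 * d) ≤ 1 / ((p : ℕ) : ℝ) ^ (2 * d) := by
    exact one_div_le_one_div_of_le (by positivity) (pow_le_pow_right₀ hp (by omega))
  linarith


/-- For every integer `d ≥ 2`, one has
`(1 - 2^{-d} + 2^{-2d}) · ∏_{p odd prime} (1 - p^{-2d} + p^{-3d}) ≤ 1/ζ(2d)`,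
where `ζ` is the Riemann zeta function (real-valued at the real argument `2d > 1`). -/
theorem local_density_product_le_inv_zeta (d : ℕ) (hd : 2 ≤ d) :
    (1 - 1 / (2 : ℝ) ^ d + 1 / (2 : ℝ) ^ (2 * d)) *
        ∏' p : {p : ℕ // p.Prime ∧ Odd p},
          (1 - 1 / (((p : ℕ) : ℝ) ^ (2 * d)) + 1 / (((p : ℕ) : ℝ) ^ (3 * d))) ≤
      1 / (riemannZeta ((2 * d : ℕ) : ℂ)).re := by
  refine ge_of_tendsto (tendsto_prod_primesBelow_inv_riemannZeta_re (by omega)) ?_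
  filter_upwards [eventually_ge_atTop 3] with n hn
  refine le_trans ?_ (mul_prod_local_density_le hd hn)
  refine mul_le_mul_of_nonneg_left (tprod_local_density_le_prod hd n) ?_
  exact add_nonneg (by exact_mod_cast one_sub_one_div_pow_nonneg 2 d) (by positivity)
end
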